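/- arXiv:2109.07114 — 2 statements merged into one kernel-verified Lean document; each statement's English description precedes it below -/
import Mathlib

section
/- For α with 0 < α < 2 and β > 0, there exists a constant c > 0 (depending only on α and β) such that |E_{α,β}(-z)| ≤ c/(1+z) for all real z ≥ 0. -/
/-- The real Mittag-Leffler function `E_{α,β}(x) = ∑_{k=0}^∞ x^k / Γ(kα + β)`. -/
noncomputable def mittagLefflerReal (α β x : ℝ) : ℝ :=
  ∑' k : ℕ, x ^ k / Real.Gamma ((k : ℝ) * α + β)

open MeasureTheory Set Filter Topology

namespace MittagLeffler

/-- The point with parameter `v` on the vertical line `Re w = 1`. -/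
noncomputable def line (v : ℝ) : ℂ := 1 + 2 * Real.pi * v * Complex.I

lemma line_re (v : ℝ) : (line v).re = 1 := by simp [line]

lemma line_im (v : ℝ) : (line v).im = 2 * Real.pi * v := by simp [line]

lemma one_le_norm_line (v : ℝ) : 1 ≤ ‖line v‖ := by
  simpa [line_re] using Complex.abs_re_le_norm (line v)

lemma line_ne_zero (v : ℝ) : line v ≠ 0 :=
  norm_pos_iff.mp (zero_lt_one.trans_le (one_le_norm_line v))

lemma continuous_line : Continuous line := by
  unfold line; fun_prop

lemma line_mem_slitPlane (v : ℝ) : line v ∈ Complex.slitPlane := by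
  left; simp [line_re]

lemma continuous_line_cpow (s : ℂ) : Continuous fun v => line v ^ s :=
  continuous_line.cpow continuous_const line_mem_slitPlane

lemma norm_exp_line (v : ℝ) : ‖Complex.exp (line v)‖ = Real.exp 1 := by
  rw [Complex.norm_exp, line_re]

lemma continuous_norm_line_rpow (r : ℝ) : Continuous fun v => ‖line v‖ ^ r :=
  continuous_line.norm.rpow_const fun v => .inl (norm_ne_zero_iff.mpr (line_ne_zero v))

lemma integrable_norm_line_rpow {r : ℝ} (hr : r ≤ -2) : Integrable fun v => ‖line v‖ ^ r := by
  refine integrable_inv_one_add_sq.mono' (continuous_norm_line_rpow r).aestronglyMeasurable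
    (ae_of_all _ fun v => ?_)
  rw [Real.norm_of_nonneg (by positivity)]
  calc ‖line v‖ ^ r ≤ ‖line v‖ ^ (-2 : ℝ) :=
        Real.rpow_le_rpow_of_exponent_le (one_le_norm_line v) hr
    _ = (‖line v‖ ^ 2)⁻¹ := by
        rw [Real.rpow_neg (norm_nonneg _)]; norm_num
    _ ≤ (1 + v ^ 2)⁻¹ := by
        rw [Complex.sq_norm, Complex.normSq_apply, line_re, line_im]
        gcongr
        · norm_num
        nlinarith [mul_nonneg (sq_nonneg v) (by nlinarith [Real.pi_gt_three] :
          (0 : ℝ) ≤ 4 * Real.pi ^ 2 - 1)]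

lemma integrableOn_rpow_mul_exp_neg_mul {p b : ℝ} (hp : -1 < p) (hb : 0 < b) :
    IntegrableOn (fun t : ℝ => t ^ p * Real.exp (-b * t)) (Ioi 0) := by
  simpa using integrableOn_rpow_mul_exp_neg_mul_rpow hp zero_lt_one hb

lemma norm_cpow_mul_exp_neg_mul {t : ℝ} (ht : 0 < t) (a r : ℂ) :
    ‖(t : ℂ) ^ a * Complex.exp (-(r * t))‖ = t ^ a.re * Real.exp (-r.re * t) := by
  rw [norm_mul, Complex.norm_cpow_eq_rpow_re_of_pos ht, Complex.norm_exp]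
  simp

lemma differentiableAt_integral_cpow_mul_exp_neg_mul {a r : ℂ} (ha : 0 < a.re) (hr : 0 < r.re) :
    DifferentiableAt ℂ
      (fun r : ℂ => ∫ t : ℝ in Ioi 0, (t : ℂ) ^ (a - 1) * Complex.exp (-(r * t))) r := by
  have hmeas : ∀ a r : ℂ, AEStronglyMeasurable
      (fun t : ℝ => (t : ℂ) ^ a * Complex.exp (-(r * t))) (volume.restrict (Ioi 0)) := by
    intro a r
    refine ContinuousOn.aestronglyMeasurable (fun t ht => ?_) measurableSet_Ioi
    refine ContinuousAt.continuousWithinAt (ContinuousAt.mul ?_ (by fun_prop))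
    exact Complex.continuous_ofReal.continuousAt.cpow continuousAt_const
      (Complex.ofReal_mem_slitPlane.mpr ht)
  have hpos := ae_restrict_mem (μ := volume) (measurableSet_Ioi (a := (0 : ℝ)))
  refine (hasDerivAt_integral_of_dominated_loc_of_deriv_le
    (F' := fun r t => -((t : ℂ) ^ a * Complex.exp (-(r * t))))
    (bound := fun t => t ^ a.re * Real.exp (-(r.re / 2) * t))
    ((Complex.continuous_re.isOpen_preimage _ isOpen_Ioi).mem_nhds
      (show r.re / 2 < r.re by linarith)) (Eventually.of_forall fun r => hmeas _ r) ?_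
    (hmeas a r).neg ?_ (integrableOn_rpow_mul_exp_neg_mul (by linarith) (by linarith))
    ?_).2.differentiableAt
  · refine (integrableOn_rpow_mul_exp_neg_mul (p := (a - 1).re) (by simpa using ha) hr).mono'
      (hmeas _ r) (hpos.mono fun t ht => (norm_cpow_mul_exp_neg_mul ht _ r).le)
  · filter_upwards [hpos] with t ht w hw
    have hw' : r.re / 2 < w.re := hw
    have ht' : 0 < t := ht
    rw [norm_neg, norm_cpow_mul_exp_neg_mul ht']
    gcongr
  · filter_upwards [hpos] with t ht w _
    have ht0 : (t : ℂ) ≠ 0 := Complex.ofReal_ne_zero.mpr (ne_of_gt ht)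
    have h := ((((hasDerivAt_id w).mul_const (t : ℂ)).neg).cexp).const_mul ((t : ℂ) ^ (a - 1))
    refine h.congr_deriv ?_
    rw [Complex.cpow_sub _ _ ht0, Complex.cpow_one]
    simp only [id, Pi.neg_apply]
    field_simp

/-- The Gamma integral with a complex scale. -/
lemma integral_cpow_mul_exp_neg_mul_Ioi_of_re_pos {a r : ℂ} (ha : 0 < a.re) (hr : 0 < r.re) :
    ∫ t : ℝ in Ioi 0, (t : ℂ) ^ (a - 1) * Complex.exp (-(r * t)) =
      (1 / r) ^ a * Complex.Gamma a := by
  have hU : IsOpen {w : ℂ | 0 < w.re} := Complex.continuous_re.isOpen_preimage _ isOpen_Ioi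
  have hL : AnalyticOnNhd ℂ
      (fun r : ℂ => ∫ t : ℝ in Ioi 0, (t : ℂ) ^ (a - 1) * Complex.exp (-(r * t)))
      {w : ℂ | 0 < w.re} :=
    DifferentiableOn.analyticOnNhd (fun w hw =>
      (differentiableAt_integral_cpow_mul_exp_neg_mul ha hw).differentiableWithinAt) hU
  have hR : AnalyticOnNhd ℂ (fun r : ℂ => (1 / r) ^ a * Complex.Gamma a) {w : ℂ | 0 < w.re} := by
    refine DifferentiableOn.analyticOnNhd (fun w hw => ?_) hU
    have hw' : 0 < w.re := hw
    have hw0 : w ≠ 0 := by rintro rfl; simp at hw'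
    refine (DifferentiableAt.mul_const (DifferentiableAt.cpow ?_ (by fun_prop) ?_)
      _).differentiableWithinAt
    · exact (differentiableAt_const _).div differentiableAt_id hw0
    · left
      rw [one_div, Complex.inv_re]
      exact div_pos hw' (Complex.normSq_pos.mpr hw0)
  refine hL.eqOn_of_preconnected_of_frequently_eq hR (convex_halfSpace_re_gt 0).isPreconnected
    (z₀ := 1) (by simp) ?_ hr
  have htend : Tendsto ((↑) : ℝ → ℂ) (𝓝[≠] 1) (𝓝[≠] 1) := by
    refine tendsto_nhdsWithin_iff.mpr ⟨?_, ?_⟩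
    · exact (Complex.continuous_ofReal.tendsto' 1 1 (by simp)).mono_left nhdsWithin_le_nhds
    · filter_upwards [self_mem_nhdsWithin] with t ht
      simpa using ht
  refine htend.frequently (Eventually.frequently ?_)
  filter_upwards [nhdsWithin_le_nhds (Ioi_mem_nhds zero_lt_one)] with t ht
  exact Complex.integral_cpow_mul_exp_neg_mul_Ioi ha ht

/-- Bromwich's integral for the reciprocal of the Gamma function. -/
lemma integral_exp_line_mul_cpow {s : ℝ} (hs : 2 ≤ s) :
    ∫ v, Complex.exp (line v) * line v ^ (-s : ℂ) = ((Real.Gamma s)⁻¹ : ℝ) := by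
  set f : ℝ → ℂ := (Ioi 0).indicator fun t => (t : ℂ) ^ ((s : ℂ) - 1) * Complex.exp (-t) with hf
  have hfR : ∀ t ∈ Ioi (0 : ℝ), (t : ℂ) ^ ((s : ℂ) - 1) * Complex.exp (-t) =
      ((Real.exp (-t) * t ^ (s - 1) : ℝ) : ℂ) := by
    intro t ht
    push_cast [Complex.ofReal_cpow (le_of_lt ht)]
    ring
  have hfi : Integrable f := by
    rw [hf, integrable_indicator_iff measurableSet_Ioi]
    exact IntegrableOn.congr_fun (Real.GammaIntegral_convergent (by linarith : 0 < s)).ofReal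
      (fun t ht => (hfR t ht).symm) measurableSet_Ioi
  have hfour : FourierTransform.fourier f =
      fun v => line v ^ (-s : ℂ) * (Real.Gamma s : ℂ) := by
    ext v
    rw [Real.fourier_real_eq_integral_exp_smul]
    have h := integral_cpow_mul_exp_neg_mul_Ioi_of_re_pos (a := (s : ℂ)) (r := line v)
      (by rw [Complex.ofReal_re]; linarith) (by simp [line_re])
    rw [one_div, Complex.inv_cpow _ _ (Complex.slitPlane_arg_ne_pi (line_mem_slitPlane v)),
      ← Complex.cpow_neg, Complex.Gamma_ofReal] at h
    rw [← h, ← integral_indicator measurableSet_Ioi]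
    congr 1 with t
    by_cases ht : t ∈ Ioi (0 : ℝ)
    · simp only [hf, indicator_of_mem ht, smul_eq_mul, line]
      rw [mul_left_comm, ← Complex.exp_add]
      congr 2
      push_cast
      ring
    · simp [hf, indicator_of_notMem ht]
  have hint : Integrable fun v => line v ^ (-s : ℂ) := by
    refine (integrable_norm_line_rpow (r := -s) (by linarith)).mono'
      (continuous_line_cpow _).aestronglyMeasurable (ae_of_all _ fun v => ?_)
    rw [← Complex.ofReal_neg, Complex.norm_cpow_real]
  have hc : ContinuousAt f 1 := by
    have : ContinuousAt (fun t : ℝ => (t : ℂ) ^ ((s : ℂ) - 1) * Complex.exp (-t)) 1 := by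
      refine ContinuousAt.mul ?_ (by fun_prop)
      exact Complex.continuous_ofReal.continuousAt.cpow continuousAt_const (by simp)
    refine this.congr ?_
    filter_upwards [Ioi_mem_nhds (zero_lt_one : (0 : ℝ) < 1)] with t ht
    simp [hf, indicator_of_mem ht]
  have hinv := hfi.fourierInv_fourier_eq (by rw [hfour]; exact hint.mul_const _) hc
  rw [hfour, Real.fourierInv_eq'] at hinv
  have hG : (Real.Gamma s : ℂ) ≠ 0 :=
    Complex.ofReal_ne_zero.mpr (Real.Gamma_pos_of_pos (by linarith)).ne'
  have h1 : f 1 = Complex.exp (-1) := by simp [hf]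
  rw [h1] at hinv
  have h2 : ∀ v, Complex.exp (line v) * line v ^ (-s : ℂ) =
      (Complex.exp 1 * (Real.Gamma s : ℂ)⁻¹) *
      (Complex.exp (↑(2 * Real.pi * inner ℝ v 1) * Complex.I) •
        (line v ^ (-s : ℂ) * (Real.Gamma s : ℂ))) := by
    intro v
    have : Complex.exp (line v) = Complex.exp 1 *
        Complex.exp (↑(2 * Real.pi * inner ℝ v 1) * Complex.I) := by
      rw [← Complex.exp_add]; simp [line]
    rw [this, smul_eq_mul]
    field_simp
  simp_rw [h2]
  rw [integral_const_mul, hinv, Complex.ofReal_inv, mul_right_comm, ← Complex.exp_add]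
  simp

lemma rpow_mul_exp_neg_le_Gamma {M s : ℝ} (hM : 0 < M) (hs : 1 ≤ s) :
    M ^ (s - 1) * Real.exp (-M) ≤ Real.Gamma s := by
  have hi := Real.GammaIntegral_convergent (by linarith : 0 < s)
  rw [Real.Gamma_eq_integral (by linarith), ← integral_exp_neg_Ioi M, ← integral_const_mul]
  calc ∫ x in Ioi M, M ^ (s - 1) * Real.exp (-x)
      ≤ ∫ x in Ioi M, Real.exp (-x) * x ^ (s - 1) := by
        refine setIntegral_mono_on ((integrableOn_exp_neg_Ioi M).const_mul _)
          (hi.mono_set (Ioi_subset_Ioi hM.le)) measurableSet_Ioi fun x hx => ?_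
        rw [mul_comm]
        gcongr
        exact (mem_Ioi.mp hx).le
    _ ≤ _ := setIntegral_mono_set hi
        ((ae_restrict_mem measurableSet_Ioi).mono fun x (hx : 0 < x) => by positivity)
        (Ioi_subset_Ioi hM.le).eventuallyLE

lemma summable_pow_div_Gamma {α : ℝ} (hα : 0 < α) (β : ℝ) {R : ℝ} (hR : 0 ≤ R) :
    Summable fun k : ℕ => R ^ k / Real.Gamma (k * α + β) := by
  obtain ⟨M, hM, hMR⟩ : ∃ M : ℝ, 0 < M ∧ M ^ α = 2 * R + 1 :=
    ⟨(2 * R + 1) ^ α⁻¹, by positivity, Real.rpow_inv_rpow (by positivity) hα.ne'⟩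
  have hg : Summable fun k : ℕ => (R / (2 * R + 1)) ^ k * (M ^ (β - 1) * Real.exp (-M))⁻¹ := by
    refine (summable_geometric_of_lt_one (by positivity) ?_).mul_right _
    rw [div_lt_one (by positivity)]
    linarith
  refine summable_of_isBigO_nat hg (Asymptotics.IsBigO.of_bound 1 ?_)
  have htend : Tendsto (fun k : ℕ => (k : ℝ) * α + β) atTop atTop :=
    tendsto_atTop_add_const_right _ _ (tendsto_natCast_atTop_atTop.atTop_mul_const hα)
  filter_upwards [htend.eventually_ge_atTop 1] with k hk
  have hG := rpow_mul_exp_neg_le_Gamma hM hk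
  have hM' : M ^ (k * α + β - 1) * Real.exp (-M) =
      (2 * R + 1) ^ k * (M ^ (β - 1) * Real.exp (-M)) := by
    rw [add_sub_assoc, Real.rpow_add hM, mul_comm (k : ℝ), Real.rpow_mul_natCast hM.le, hMR]
    ring
  rw [hM'] at hG
  rw [one_mul, Real.norm_of_nonneg (div_nonneg (by positivity) (hG.trans' (by positivity))),
    Real.norm_of_nonneg (by positivity), div_pow, ← div_eq_mul_inv, div_div]
  gcongr

/-- The Mittag-Leffler function `z ↦ E_{α,β}(-z)` of a complex variable. -/
noncomputable def mlNeg (α β : ℝ) (z : ℂ) : ℂ :=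
  ∑' k : ℕ, (-z) ^ k * ((Real.Gamma (k * α + β))⁻¹ : ℝ)

lemma norm_mlNeg_term_le {α β : ℝ} (hα : 0 < α) (hβ : 0 < β) {z : ℂ} {R : ℝ} (hz : ‖z‖ ≤ R)
    (k : ℕ) : ‖(-z) ^ k * ((Real.Gamma (k * α + β))⁻¹ : ℝ)‖ ≤
      R ^ k / Real.Gamma (k * α + β) := by
  have hG : 0 < Real.Gamma (k * α + β) := Real.Gamma_pos_of_pos (by positivity)
  rw [norm_mul, norm_pow, norm_neg, Complex.norm_real, Real.norm_of_nonneg (by positivity),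
    ← div_eq_mul_inv]
  gcongr

lemma hasSum_mlNeg {α β : ℝ} (hα : 0 < α) (hβ : 0 < β) (z : ℂ) :
    HasSum (fun k : ℕ => (-z) ^ k * (((Real.Gamma (k * α + β))⁻¹ : ℝ) : ℂ)) (mlNeg α β z) :=
  ((summable_pow_div_Gamma hα β (norm_nonneg z)).of_norm_bounded
    (norm_mlNeg_term_le hα hβ le_rfl)).hasSum

lemma mlNeg_ofReal (α β x : ℝ) : mlNeg α β x = (mittagLefflerReal α β (-x) : ℝ) := by
  rw [mlNeg, mittagLefflerReal, Complex.ofReal_tsum]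
  simp [div_eq_mul_inv]

lemma differentiable_mlNeg {α β : ℝ} (hα : 0 < α) (hβ : 0 < β) :
    Differentiable ℂ (mlNeg α β) := by
  intro z
  have hU : IsOpen (Metric.ball (0 : ℂ) (‖z‖ + 1)) := Metric.isOpen_ball
  refine (Complex.differentiableOn_tsum_of_summable_norm
    (summable_pow_div_Gamma hα β (by positivity : 0 ≤ ‖z‖ + 1)) (fun k => by fun_prop) hU
    fun k w hw => norm_mlNeg_term_le hα hβ (mem_ball_zero_iff.mp hw).le k).differentiableAt
    (hU.mem_nhds (by simp))

/-- Lowering the second parameter by one. -/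
lemma mlNeg_eq_deriv {α β : ℝ} (hα : 0 < α) (hβ : 0 < β) (z : ℂ) :
    mlNeg α β z = β * mlNeg α (β + 1) z + α * (z * deriv (mlNeg α (β + 1)) z) := by
  have hβ1 : 0 < β + 1 := by positivity
  have hU : IsOpen (Metric.ball (0 : ℂ) (‖z‖ + 1)) := Metric.isOpen_ball
  have hd := Complex.hasSum_deriv_of_summable_norm
    (summable_pow_div_Gamma hα (β + 1) (by positivity : 0 ≤ ‖z‖ + 1))
    (F := fun (k : ℕ) (w : ℂ) => (-w) ^ k * (((Real.Gamma (k * α + (β + 1)))⁻¹ : ℝ) : ℂ))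
    (fun k => by fun_prop) hU
    (fun k w hw => norm_mlNeg_term_le hα hβ1 (mem_ball_zero_iff.mp hw).le k)
    (by simp : z ∈ Metric.ball (0 : ℂ) (‖z‖ + 1))
  have hs := ((hasSum_mlNeg hα hβ1 z).mul_left (β : ℂ)).add ((hd.mul_left z).mul_left (α : ℂ))
  refine (tsum_congr fun k => ?_).trans hs.tsum_eq
  have hk : 0 < k * α + β := by positivity
  have hD : deriv (fun w : ℂ => (-w) ^ k * (((Real.Gamma (k * α + (β + 1)))⁻¹ : ℝ) : ℂ)) z =
      -(k * (-z) ^ (k - 1)) * (((Real.Gamma (k * α + (β + 1)))⁻¹ : ℝ) : ℂ) := by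
    have := ((hasDerivAt_id z).neg.pow k).mul_const
      (((Real.Gamma (k * α + (β + 1)))⁻¹ : ℝ) : ℂ)
    simpa using this.deriv
  have hzk : z * (k * (-z) ^ (k - 1)) = -(k * (-z) ^ k) := by
    rcases k with _ | k
    · simp
    · simp [pow_succ]; ring
  rw [hD, ← add_assoc, Real.Gamma_add_one hk.ne']
  have hk' : (k * α + β : ℂ) ≠ 0 := by exact_mod_cast hk.ne'
  have hG : (Real.Gamma (k * α + β) : ℂ) ≠ 0 := by
    exact_mod_cast (Real.Gamma_pos_of_pos hk).ne'
  push_cast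
  rw [show ∀ c : ℂ, z * (-(k * (-z) ^ (k - 1)) * c) = -(z * (k * (-z) ^ (k - 1))) * c by
    intro c; ring, hzk]
  field_simp
  ring
lemma exists_le_norm_cpow_add {α : ℝ} (hα0 : 0 < α) (hα2 : α < 2) :
    ∃ κ : ℝ, 0 < κ ∧ ∀ w : ℂ, 0 ≤ w.re → ∀ x : ℝ, 0 ≤ x →
      κ * (‖w‖ ^ α + x) ≤ ‖w ^ (α : ℂ) + x‖ := by
  have hπ := Real.pi_pos
  set c := Real.cos (Real.pi / 2 * α) with hc
  have hc1 : -1 < c := by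
    rw [hc, ← Real.cos_pi]
    exact Real.cos_lt_cos_of_nonneg_of_le_pi (by positivity) le_rfl (by nlinarith)
  have hc2 : c ≤ 1 := Real.cos_le_one _
  refine ⟨√((1 + c) / 2), Real.sqrt_pos.mpr (by linarith), fun w hw x hx => ?_⟩
  have hre : ‖w‖ ^ α * c ≤ (w ^ (α : ℂ)).re := by
    rw [Complex.cpow_ofReal_re]
    gcongr
    rw [hc, ← Real.cos_abs (w.arg * α), abs_mul, abs_of_pos hα0]
    have harg := Complex.abs_arg_le_pi_div_two_iff.mpr hw
    exact Real.cos_le_cos_of_nonneg_of_le_pi (by positivity) (by nlinarith) (by gcongr)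
  have hu : ‖w ^ (α : ℂ)‖ = ‖w‖ ^ α := Complex.norm_cpow_real w α
  have hu2 : (w ^ (α : ℂ)).re ^ 2 + (w ^ (α : ℂ)).im ^ 2 = (‖w‖ ^ α) ^ 2 := by
    rw [← hu, Complex.sq_norm, Complex.normSq_apply]
    ring
  refine abs_le_of_sq_le_sq' ?_ (norm_nonneg _) |>.2
  rw [mul_pow, Real.sq_sqrt (by linarith), Complex.sq_norm, Complex.normSq_apply]
  simp only [Complex.add_re, Complex.add_im, Complex.ofReal_re, Complex.ofReal_im, add_zero]
  nlinarith [mul_le_mul_of_nonneg_left hre hx,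
    mul_nonneg (by linarith : 0 ≤ 1 - c) (sq_nonneg (‖w‖ ^ α - x))]

lemma exists_le_norm_line_cpow_add {α : ℝ} (hα0 : 0 < α) (hα2 : α < 2) :
    ∃ ε : ℝ, 0 < ε ∧ ∀ (v x : ℝ) (z : ℂ), 0 ≤ x → ‖z - x‖ ≤ ε * (1 + x) →
      ε * (1 + x) ≤ ‖line v ^ (α : ℂ) + z‖ := by
  obtain ⟨κ, hκ, h⟩ := exists_le_norm_cpow_add hα0 hα2
  refine ⟨κ / 2, by positivity, fun v x z hx hz => ?_⟩
  have h1 := h (line v) (by simp [line_re]) x hx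
  have h2 : 1 ≤ ‖line v‖ ^ α := Real.one_le_rpow (one_le_norm_line v) hα0.le
  have h3 : ‖line v ^ (α : ℂ) + x‖ ≤ ‖line v ^ (α : ℂ) + z‖ + ‖z - x‖ := by
    rw [show line v ^ (α : ℂ) + x = line v ^ (α : ℂ) + z - (z - x) by ring]
    exact norm_sub_le _ _
  nlinarith

/-- An open convex neighbourhood of the nonnegative real axis that widens linearly. -/
def sector (ε : ℝ) : Set ℂ := {z | ∃ x : ℝ, 0 ≤ x ∧ ‖z - x‖ < ε * (1 + x)}

lemma isOpen_sector (ε : ℝ) : IsOpen (sector ε) := by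
  have : sector ε = ⋃ x : ℝ, ⋃ _ : 0 ≤ x, Metric.ball (x : ℂ) (ε * (1 + x)) := by
    ext z
    simp [sector, dist_eq_norm]
  rw [this]
  exact isOpen_iUnion fun x => isOpen_iUnion fun _ => Metric.isOpen_ball

lemma convex_sector (ε : ℝ) : Convex ℝ (sector ε) := by
  rw [convex_iff_forall_pos]
  rintro z ⟨x, hx, hz⟩ z' ⟨x', hx', hz'⟩ a b ha hb hab
  refine ⟨a * x + b * x', by positivity, ?_⟩
  calc ‖a • z + b • z' - ((a * x + b * x' : ℝ) : ℂ)‖ = ‖a • (z - x) + b • (z' - x')‖ := by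
        congr 1
        simp only [Complex.real_smul]
        push_cast
        ring
    _ ≤ a * ‖z - x‖ + b * ‖z' - x'‖ := by
        refine (norm_add_le _ _).trans_eq ?_
        rw [norm_smul, norm_smul, Real.norm_of_nonneg ha.le, Real.norm_of_nonneg hb.le]
    _ < a * (ε * (1 + x)) + b * (ε * (1 + x')) := by gcongr
    _ = ε * (1 + (a * x + b * x')) := by linear_combination ε * hab

lemma zero_mem_sector {ε : ℝ} (hε : 0 < ε) : 0 ∈ sector ε := ⟨0, le_rfl, by simpa using hε⟩

/-- The integrand in the inverse Laplace representation of `mlNeg`. -/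
noncomputable def kernel (α β : ℝ) (z : ℂ) (v : ℝ) : ℂ :=
  Complex.exp (line v) * line v ^ ((α - β : ℝ) : ℂ) / (line v ^ (α : ℂ) + z)

section Kernel

variable {α β ε : ℝ}

lemma norm_numerator (r v : ℝ) :
    ‖Complex.exp (line v) * line v ^ (r : ℂ)‖ = Real.exp 1 * ‖line v‖ ^ r := by
  rw [norm_mul, norm_exp_line, Complex.norm_cpow_real]

lemma continuous_numerator (r : ℝ) :
    Continuous fun v => Complex.exp (line v) * line v ^ (r : ℂ) :=
  continuous_line.cexp.mul (continuous_line_cpow _)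

lemma norm_kernel_le {δ v : ℝ} {z : ℂ} (hδ : 0 < δ) (hz : δ ≤ ‖line v ^ (α : ℂ) + z‖) :
    ‖kernel α β z v‖ ≤ Real.exp 1 * ‖line v‖ ^ (α - β) / δ := by
  rw [kernel, norm_div, norm_numerator]
  gcongr

lemma hasSum_kernel (hα : 0 < α) {z : ℂ} (hz : ‖z‖ < 1) (v : ℝ) :
    HasSum (fun k : ℕ => (-z) ^ k * (Complex.exp (line v) * line v ^ (-(k * α + β : ℝ) : ℂ)))
      (kernel α β z v) := by
  have hu : line v ^ (α : ℂ) ≠ 0 := by simp [Complex.cpow_eq_zero_iff, line_ne_zero]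
  have hu1 : 1 ≤ ‖line v ^ (α : ℂ)‖ := by
    rw [Complex.norm_cpow_real]
    exact Real.one_le_rpow (one_le_norm_line v) hα.le
  have hlt : ‖-z / line v ^ (α : ℂ)‖ < 1 := by
    rw [norm_div, norm_neg, div_lt_one (by linarith)]
    linarith
  have huz : line v ^ (α : ℂ) + z ≠ 0 := by
    intro h
    rw [add_eq_zero_iff_eq_neg] at h
    rw [h, norm_neg] at hu1
    linarith
  convert! (hasSum_geometric_of_norm_lt_one hlt).mul_left
    (Complex.exp (line v) * line v ^ (-β : ℂ)) using 1
  · ext k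
    have : line v ^ (-(k * α + β : ℝ) : ℂ) = (line v ^ (α : ℂ))⁻¹ ^ k * line v ^ (-β : ℂ) := by
      rw [← Complex.cpow_neg, ← Complex.cpow_nat_mul, ← Complex.cpow_add _ _ (line_ne_zero v)]
      congr 1
      push_cast
      ring
    rw [this, div_pow, inv_pow]
    ring
  · rw [kernel, Complex.ofReal_sub, Complex.cpow_sub _ _ (line_ne_zero v), Complex.cpow_neg]
    have hb : line v ^ (β : ℂ) ≠ 0 := by simp [Complex.cpow_eq_zero_iff, line_ne_zero]
    have : 1 - -z / line v ^ (α : ℂ) = (line v ^ (α : ℂ) + z) / line v ^ (α : ℂ) := by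
      field_simp
      ring
    rw [this]
    field_simp

lemma integral_kernel_of_norm_lt_one (hα : 0 < α) (hβ : 2 ≤ β) {z : ℂ} (hz : ‖z‖ < 1) :
    ∫ v, kernel α β z v = mlNeg α β z := by
  have hcont : ∀ r : ℝ, Continuous fun v => Complex.exp (line v) * line v ^ (-r : ℂ) := by
    intro r
    exact_mod_cast continuous_numerator (-r)
  have hint : ∀ k : ℕ, Integrable fun v =>
      (-z) ^ k * (Complex.exp (line v) * line v ^ (-(k * α + β : ℝ) : ℂ)) := by
    intro k
    have hkα : 0 ≤ k * α := by positivity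
    have hk : -(k * α + β) ≤ -2 := by linarith
    refine Integrable.const_mul (((integrable_norm_line_rpow hk).const_mul (Real.exp 1)).mono'
      (hcont _).aestronglyMeasurable (ae_of_all _ fun v => ?_)) _
    rw [← norm_numerator, Complex.ofReal_neg]
  have hnorm : ∀ k : ℕ, ∫ v, ‖(-z) ^ k *
      (Complex.exp (line v) * line v ^ (-(k * α + β : ℝ) : ℂ))‖ ≤
      ‖z‖ ^ k * ∫ v, Real.exp 1 * ‖line v‖ ^ (-2 : ℝ) := by
    intro k
    rw [← integral_const_mul]
    refine integral_mono (hint k).norm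
      (((integrable_norm_line_rpow le_rfl).const_mul _).const_mul _) fun v => ?_
    simp only [norm_mul ((-z) ^ k), norm_pow, norm_neg]
    rw [← Complex.ofReal_neg, norm_numerator]
    gcongr
    · exact one_le_norm_line v
    · have : 0 ≤ k * α := by positivity
      linarith
  have hsum := hasSum_integral_of_summable_integral_norm hint
    (((summable_geometric_of_lt_one (norm_nonneg z) hz).mul_right _).of_nonneg_of_le
      (fun k => integral_nonneg fun v => norm_nonneg _) hnorm)
  simp only [(hasSum_kernel hα hz _).tsum_eq] at hsum
  rw [← hsum.tsum_eq, mlNeg]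
  refine tsum_congr fun k => ?_
  rw [integral_const_mul, integral_exp_line_mul_cpow]
  have : 0 ≤ k * α := by positivity
  linarith

lemma differentiableAt_integral_kernel (hβ : α + 2 ≤ β) (hε : 0 < ε)
    (h : ∀ (v x : ℝ) (z : ℂ), 0 ≤ x → ‖z - x‖ ≤ ε * (1 + x) →
      ε * (1 + x) ≤ ‖line v ^ (α : ℂ) + z‖) {z : ℂ} (hz : z ∈ sector ε) :
    DifferentiableAt ℂ (fun z => ∫ v, kernel α β z v) z := by
  have hle : ∀ w ∈ sector ε, ∀ v, ε ≤ ‖line v ^ (α : ℂ) + w‖ := by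
    rintro w ⟨x, hx, hw⟩ v
    nlinarith [h v x w hx hw.le]
  have hne : ∀ w ∈ sector ε, ∀ v, line v ^ (α : ℂ) + w ≠ 0 := fun w hw v =>
    norm_pos_iff.mp (hε.trans_le (hle w hw v))
  have hcont : ∀ w ∈ sector ε, Continuous (kernel α β w) := fun w hw =>
    (continuous_numerator _).div ((continuous_line_cpow _).add continuous_const) (hne w hw)
  have hint : Integrable fun v => Real.exp 1 * ‖line v‖ ^ (α - β) :=
    (integrable_norm_line_rpow (by linarith)).const_mul _
  have hU := (isOpen_sector ε).mem_nhds hz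
  refine (hasDerivAt_integral_of_dominated_loc_of_deriv_le
    (F' := fun w v => -(kernel α β w v / (line v ^ (α : ℂ) + w)))
    (bound := fun v => Real.exp 1 * ‖line v‖ ^ (α - β) / ε / ε) hU ?_ ?_ ?_ ?_
    ((hint.div_const _).div_const _) ?_).2.differentiableAt
  · filter_upwards [hU] with w hw using (hcont w hw).aestronglyMeasurable
  · exact (hint.div_const ε).mono' (hcont z hz).aestronglyMeasurable
      (ae_of_all _ fun v => norm_kernel_le hε (hle z hz v))
  · exact (((hcont z hz).div ((continuous_line_cpow _).add continuous_const)
      (hne z hz)).neg).aestronglyMeasurable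
  · refine ae_of_all _ fun v w hw => ?_
    rw [norm_neg, norm_div]
    gcongr
    · exact norm_kernel_le hε (hle w hw v)
    · exact hle w hw v
  · refine ae_of_all _ fun v w hw => ?_
    have hd := (((hasDerivAt_id w).const_add (line v ^ (α : ℂ))).inv (hne w hw v)).const_mul
      (Complex.exp (line v) * line v ^ ((α - β : ℝ) : ℂ))
    refine (hd.congr_deriv ?_)
    have := hne w hw v
    simp only [kernel, id]
    field_simp

/-- Inverse Laplace representation of the Mittag-Leffler function near the negative axis. -/
lemma integral_kernel_eq_mlNeg (hα : 0 < α) (hβ : α + 2 ≤ β) (hε : 0 < ε)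
    (h : ∀ (v x : ℝ) (z : ℂ), 0 ≤ x → ‖z - x‖ ≤ ε * (1 + x) →
      ε * (1 + x) ≤ ‖line v ^ (α : ℂ) + z‖) {z : ℂ} (hz : z ∈ sector ε) :
    ∫ v, kernel α β z v = mlNeg α β z := by
  have hL : AnalyticOnNhd ℂ (fun z => ∫ v, kernel α β z v) (sector ε) :=
    DifferentiableOn.analyticOnNhd (fun w hw =>
      (differentiableAt_integral_kernel hβ hε h hw).differentiableWithinAt) (isOpen_sector ε)
  have hR : AnalyticOnNhd ℂ (mlNeg α β) (sector ε) :=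
    (differentiable_mlNeg hα (by linarith)).differentiableOn.analyticOnNhd (isOpen_sector ε)
  refine hL.eqOn_of_preconnected_of_eventuallyEq hR (convex_sector ε).isPreconnected
    (zero_mem_sector hε) ?_ hz
  filter_upwards [Metric.ball_mem_nhds (0 : ℂ) zero_lt_one] with w hw
  exact integral_kernel_of_norm_lt_one hα (by linarith) (mem_ball_zero_iff.mp hw)

end Kernel

/-- `E_{α,β}(-z)` decays like `1 / (1 + |z|)` in a sector around the nonnegative axis. -/
def SectorDecay (α β : ℝ) : Prop :=
  ∃ ε > 0, ∃ C : ℝ, ∀ (x : ℝ) (z : ℂ), 0 ≤ x → ‖z - x‖ ≤ ε * (1 + x) →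
    ‖mlNeg α β z‖ ≤ C / (1 + x)

lemma sectorDecay_of_add_two_le {α β : ℝ} (hα0 : 0 < α) (hα2 : α < 2) (hβ : α + 2 ≤ β) :
    SectorDecay α β := by
  obtain ⟨ε, hε, h⟩ := exists_le_norm_line_cpow_add hα0 hα2
  refine ⟨ε / 2, by positivity, (∫ v, Real.exp 1 * ‖line v‖ ^ (α - β)) / ε,
    fun x z hx hz => ?_⟩
  have hεx : 0 < ε * (1 + x) := by positivity
  have hz' : ‖z - x‖ < ε * (1 + x) := by linarith
  rw [← integral_kernel_eq_mlNeg hα0 hβ hε h ⟨x, hx, hz'⟩, div_div, ← integral_div]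
  refine norm_integral_le_of_norm_le
    (((integrable_norm_line_rpow (by linarith)).const_mul _).div_const _)
    (ae_of_all _ fun v => norm_kernel_le hεx (h v x z hx hz'.le))

lemma SectorDecay.of_add_one {α β : ℝ} (hα : 0 < α) (hβ : 0 < β) (h : SectorDecay α (β + 1)) :
    SectorDecay α β := by
  obtain ⟨ε, hε, C, hC⟩ := h
  refine ⟨ε / 2, by positivity, β * C + α * ((1 + ε) * (C / (ε / 2))), fun x z hx hz => ?_⟩
  have hx1 : 0 < 1 + x := by positivity
  have hR : 0 < ε / 2 * (1 + x) := by positivity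
  have hderiv : ‖deriv (mlNeg α (β + 1)) z‖ ≤ C / (1 + x) / (ε / 2 * (1 + x)) := by
    refine Complex.norm_deriv_le_of_forall_mem_sphere_norm_le hR
      (differentiable_mlNeg hα (by positivity)).diffContOnCl fun w hw => hC x w hx ?_
    calc ‖w - x‖ ≤ ‖w - z‖ + ‖z - x‖ := norm_sub_le_norm_sub_add_norm_sub _ _ _
      _ ≤ ε / 2 * (1 + x) + ε / 2 * (1 + x) := by
        gcongr
        exact (mem_sphere_iff_norm.mp hw).le
      _ = ε * (1 + x) := by ring
  have hznorm : ‖z‖ ≤ (1 + ε) * (1 + x) := by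
    have := norm_le_norm_add_norm_sub (x : ℂ) z
    rw [Complex.norm_real, Real.norm_of_nonneg hx, norm_sub_rev] at this
    nlinarith
  rw [mlNeg_eq_deriv hα hβ]
  calc _ ≤ β * ‖mlNeg α (β + 1) z‖ + α * (‖z‖ * ‖deriv (mlNeg α (β + 1)) z‖) := by
        refine (norm_add_le _ _).trans_eq ?_
        simp [abs_of_pos hα, abs_of_pos hβ]
    _ ≤ β * (C / (1 + x)) +
        α * ((1 + ε) * (1 + x) * (C / (1 + x) / (ε / 2 * (1 + x)))) := by
        gcongr
        exact hC x z hx (hz.trans (by linarith))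
    _ = _ := by
        field_simp

lemma sectorDecay {α β : ℝ} (hα0 : 0 < α) (hα2 : α < 2) (hβ : 0 < β) : SectorDecay α β := by
  have hn : ∀ n : ℕ, ∀ β : ℝ, 0 < β → α + 2 ≤ β + n → SectorDecay α β := by
    intro n
    induction n with
    | zero => exact fun β _ h => sectorDecay_of_add_two_le hα0 hα2 (by simpa using h)
    | succ n ih =>
      intro β hβ h
      exact .of_add_one hα0 hβ (ih (β + 1) (by positivity) (by push_cast at h; linarith))
  exact hn 4 β hβ (by norm_num; linarith)

end MittagLeffler

/-- For `0 < α < 2` and `β > 0`, there is a constant `c > 0` (depending only on `α, β`)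
such that `|E_{α,β}(-z)| ≤ c / (1 + z)` for all real `z ≥ 0`. -/
theorem mittagLeffler_decay_bound (α β : ℝ) (hα0 : 0 < α) (hα2 : α < 2) (hβ : 0 < β) :
    ∃ c : ℝ, 0 < c ∧ ∀ z : ℝ, 0 ≤ z → |mittagLefflerReal α β (-z)| ≤ c / (1 + z) := by
  obtain ⟨ε, hε, C, hC⟩ := MittagLeffler.sectorDecay hα0 hα2 hβ
  refine ⟨max C 1, by positivity, fun z hz => ?_⟩
  have h := hC z z hz (by simpa using by positivity)
  rw [MittagLeffler.mlNeg_ofReal, Complex.norm_real, Real.norm_eq_abs] at h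
  exact h.trans (by gcongr; exact le_max_left _ _)
end

section
/- For α with 1 < α < 2, as z → ∞ one has E_{α,1}(-z) = 1/(Γ(1-α) z) + O(1/z²) and E_{α,2}(-z) = 1/(Γ(2-α) z) + O(1/z²); in particular there exist z₀ > 0 such that for all z ≥ z₀, E_{α,1}(-z) ≤ 1/(2Γ(1-α) z) < 0 and E_{α,2}(-z) ≥ 1/(2Γ(2-α) z) > 0. -/
open Filter

section HankelContour

open MeasureTheory Set Complex Topology

/-- The integral of `f` along the boundary of the half-strip `L ≤ re w`, `|im w| ≤ θ`, traversed
from `+∞ - iθ` to `+∞ + iθ`. Under `w ↦ exp w` this is a Hankel contour. -/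
noncomputable def hankelIntegral (θ L : ℝ) (f : ℂ → ℂ) : ℂ :=
  (∫ u in Ioi L, f (u + θ * I)) - (∫ u in Ioi L, f (u + (-θ : ℝ) * I))
    + I * ∫ v in (-θ)..θ, f (L + v * I)

/-- The integrand `e^ζ ζ^(a-1) dζ` of Hankel's formula, written in the variable `w = log ζ`. -/
noncomputable def hankelKernel (a : ℝ) (w : ℂ) : ℂ := exp (exp w + a * w)

lemma differentiable_hankelKernel (a : ℝ) : Differentiable ℂ (hankelKernel a) := by
  unfold hankelKernel; fun_prop

lemma continuous_hankelKernel (a : ℝ) : Continuous (hankelKernel a) :=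
  (differentiable_hankelKernel a).continuous

lemma norm_hankelKernel (a u v : ℝ) :
    ‖hankelKernel a (u + v * I)‖ = Real.exp (Real.exp u * Real.cos v + a * u) := by
  simp [hankelKernel, norm_exp, exp_re]

lemma continuous_horizontal {f : ℂ → ℂ} (hf : Continuous f) (v : ℝ) :
    Continuous fun u : ℝ => f (u + v * I) := by fun_prop

lemma continuous_vertical {f : ℂ → ℂ} (hf : Continuous f) (u : ℝ) :
    Continuous fun v : ℝ => f (u + v * I) := by fun_prop

lemma tendsto_exp_mul_sub_mul_exp_atTop {c : ℝ} (hc : 0 < c) (a : ℝ) :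
    Tendsto (fun u : ℝ => Real.exp (a * u - c * Real.exp u)) atTop (𝓝 0) := by
  have h := (tendsto_rpow_mul_exp_neg_mul_atTop_nhds_zero a c hc).comp Real.tendsto_exp_atTop
  refine h.congr fun u => ?_
  simp only [Function.comp_apply]
  rw [← Real.exp_mul, ← Real.exp_add]
  ring_nf

lemma integrableOn_exp_mul_sub_mul_exp_Ioi {c : ℝ} (hc : 0 < c) (a L : ℝ) :
    IntegrableOn (fun u : ℝ => Real.exp (a * u - c * Real.exp u)) (Ioi L) := by
  refine integrable_of_isBigO_exp_neg one_pos (by fun_prop) ?_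
  have h := (tendsto_exp_mul_sub_mul_exp_atTop hc (a + 1)).isBigO_one ℝ
  refine (h.mul (Asymptotics.isBigO_refl (fun u : ℝ => Real.exp (-1 * u)) atTop)).congr
    (fun u => ?_) (fun u => by simp)
  rw [← Real.exp_add]
  ring_nf

lemma integrable_exp_mul_sub_mul_exp {c a : ℝ} (hc : 0 < c) (ha : 0 < a) :
    Integrable (fun u : ℝ => Real.exp (a * u - c * Real.exp u)) := by
  rw [← integrableOn_univ, ← Iic_union_Ioi (a := (0 : ℝ))]
  refine IntegrableOn.union ?_ (integrableOn_exp_mul_sub_mul_exp_Ioi hc a 0)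
  refine (integrableOn_exp_mul_Iic ha 0).mono' (by fun_prop) (ae_of_all _ fun u => ?_)
  rw [Real.norm_of_nonneg (Real.exp_nonneg _)]
  gcongr
  have := mul_pos hc (Real.exp_pos u)
  linarith

lemma integrableOn_hankelKernel {v : ℝ} (hv : Real.cos v < 0) (a L : ℝ) :
    IntegrableOn (fun u : ℝ => hankelKernel a (u + v * I)) (Ioi L) := by
  refine (integrableOn_exp_mul_sub_mul_exp_Ioi (neg_pos.2 hv) a L).mono'
    (continuous_horizontal (continuous_hankelKernel a) v).aestronglyMeasurable
    (ae_of_all _ fun u => ?_)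
  rw [norm_hankelKernel]
  apply le_of_eq
  ring_nf

lemma integrable_hankelKernel {v a : ℝ} (hv : Real.cos v < 0) (ha : 0 < a) :
    Integrable (fun u : ℝ => hankelKernel a (u + v * I)) := by
  refine (integrable_exp_mul_sub_mul_exp (neg_pos.2 hv) ha).mono'
    (continuous_horizontal (continuous_hankelKernel a) v).aestronglyMeasurable
    (ae_of_all _ fun u => ?_)
  rw [norm_hankelKernel]
  apply le_of_eq
  ring_nf

lemma tendsto_hankelKernel_atTop {v : ℝ} (hv : Real.cos v < 0) (a : ℝ) :
    Tendsto (fun u : ℝ => hankelKernel a (u + v * I)) atTop (𝓝 0) := by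
  rw [tendsto_zero_iff_norm_tendsto_zero]
  refine (tendsto_exp_mul_sub_mul_exp_atTop (neg_pos.2 hv) a).congr fun u => ?_
  rw [norm_hankelKernel]
  ring_nf

lemma norm_hankelKernel_le_of_nonpos {a u v : ℝ} (hu : u ≤ 0) :
    ‖hankelKernel a (u + v * I)‖ ≤ Real.exp (1 + a * u) := by
  rw [norm_hankelKernel]
  gcongr
  have h1 : Real.exp u ≤ 1 := Real.exp_le_one_iff.2 hu
  nlinarith [Real.cos_le_one v, Real.exp_pos u]

/-- Integrals over vertical segments vanish in the limit when the integrand is uniformly small. -/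
lemma tendsto_vertical_integral_zero {f : ℂ → ℂ} {l : Filter ℝ} {B : ℝ → ℝ} {v₀ v₁ : ℝ}
    (hle : v₀ ≤ v₁) (hB : Tendsto B l (𝓝 0))
    (hf : ∀ᶠ L in l, ∀ v ∈ Icc v₀ v₁, ‖f ((L : ℝ) + v * I)‖ ≤ B L) :
    Tendsto (fun L : ℝ => ∫ v in v₀..v₁, f (L + v * I)) l (𝓝 0) := by
  have h0 : Tendsto (fun L => B L * |v₁ - v₀|) l (𝓝 0) := by simpa using hB.mul_const |v₁ - v₀|
  refine squeeze_zero_norm' ?_ h0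
  filter_upwards [hf] with L hL
  refine intervalIntegral.norm_integral_le_of_norm_le_const fun v hv => hL v ?_
  rw [uIoc_of_le hle] at hv
  exact Ioc_subset_Icc_self hv

lemma integral_rectangle_eq_zero {f : ℂ → ℂ} {v₀ v₁ : ℝ} (hle : v₀ ≤ v₁)
    (hf : ∀ w : ℂ, w.im ∈ Icc v₀ v₁ → DifferentiableAt ℂ f w) (L L' : ℝ) :
    (∫ u in L..L', f (u + v₀ * I)) - (∫ u in L..L', f (u + v₁ * I))
      + I * (∫ v in v₀..v₁, f (L' + v * I)) - I * (∫ v in v₀..v₁, f (L + v * I)) = 0 := by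
  have h := integral_boundary_rect_eq_zero_of_differentiableOn f (L + v₀ * I) (L' + v₁ * I)
    (fun w hw => (hf w ?_).differentiableWithinAt)
  · simpa using h
  · have := hw.2
    simp only [mem_preimage, add_im, ofReal_im, mul_im, ofReal_re, I_im, I_re, mul_one, mul_zero,
      add_zero, zero_add] at this
    rwa [uIcc_of_le hle] at this

lemma hankelIntegral_eq {f : ℂ → ℂ} {θ : ℝ} (hθ : 0 ≤ θ)
    (hf : ∀ w : ℂ, w.im ∈ Icc (-θ) θ → DifferentiableAt ℂ f w)
    (hp : ∀ L : ℝ, IntegrableOn (fun u : ℝ => f (u + θ * I)) (Ioi L))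
    (hm : ∀ L : ℝ, IntegrableOn (fun u : ℝ => f (u + (-θ : ℝ) * I)) (Ioi L)) (L L' : ℝ) :
    hankelIntegral θ L f = hankelIntegral θ L' f := by
  have h := integral_rectangle_eq_zero (by linarith : -θ ≤ θ) hf L L'
  have h1 := intervalIntegral.integral_interval_add_Ioi (hp L) (hp L')
  have h2 := intervalIntegral.integral_interval_add_Ioi (hm L) (hm L')
  unfold hankelIntegral
  rw [← h1, ← h2]
  linear_combination -h

/-- Collapsing a Hankel contour onto the two lines `im w = ±θ`. -/
lemma hankelIntegral_eq_integral {f : ℂ → ℂ} {θ : ℝ} (hθ : 0 ≤ θ)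
    (hf : ∀ w : ℂ, w.im ∈ Icc (-θ) θ → DifferentiableAt ℂ f w)
    (hp : Integrable (fun u : ℝ => f (u + θ * I)))
    (hm : Integrable (fun u : ℝ => f (u + (-θ : ℝ) * I))) {B : ℝ → ℝ}
    (hB : Tendsto B atBot (𝓝 0))
    (hfB : ∀ᶠ L in atBot, ∀ v ∈ Icc (-θ) θ, ‖f ((L : ℝ) + v * I)‖ ≤ B L) (L : ℝ) :
    hankelIntegral θ L f = (∫ u : ℝ, f (u + θ * I)) - ∫ u : ℝ, f (u + (-θ : ℝ) * I) := by
  have hlim : Tendsto (fun L' => hankelIntegral θ L' f) atBot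
      (𝓝 ((∫ u : ℝ, f (u + θ * I)) - (∫ u : ℝ, f (u + (-θ : ℝ) * I)) + I * 0)) :=
    (((aecover_Ioi tendsto_id).integral_tendsto_of_countably_generated hp).sub
      ((aecover_Ioi tendsto_id).integral_tendsto_of_countably_generated hm)).add
      ((tendsto_vertical_integral_zero (by linarith) hB hfB).const_mul I)
  rw [mul_zero, add_zero] at hlim
  refine tendsto_nhds_unique (tendsto_const_nhds.congr fun L' => ?_) hlim
  exact hankelIntegral_eq hθ hf (fun _ => hp.integrableOn) (fun _ => hm.integrableOn) L L'

lemma hankelIntegral_hasSum {f : ℕ → ℂ → ℂ} {F g : ℂ → ℂ} {θ L q : ℝ} (hq0 : 0 ≤ q) (hq1 : q < 1)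
    (hf : ∀ k, Continuous (f k)) (hg : Continuous g)
    (hp : IntegrableOn (fun u : ℝ => g (u + θ * I)) (Ioi L))
    (hm : IntegrableOn (fun u : ℝ => g (u + (-θ : ℝ) * I)) (Ioi L))
    (hfg : ∀ k (w : ℂ), L ≤ w.re → ‖f k w‖ ≤ q ^ k * ‖g w‖)
    (hF : ∀ w : ℂ, L ≤ w.re → HasSum (fun k => f k w) (F w)) :
    HasSum (fun k => hankelIntegral θ L (f k)) (hankelIntegral θ L F) := by
  have hgeom := summable_geometric_of_lt_one hq0 hq1
  have horizontal (v : ℝ) (hv : IntegrableOn (fun u : ℝ => g (u + v * I)) (Ioi L)) :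
      HasSum (fun k => ∫ u in Ioi L, f k (u + v * I)) (∫ u in Ioi L, F (u + v * I)) := by
    have hle (k : ℕ) : ∀ᵐ u : ℝ ∂volume.restrict (Ioi L),
        ‖f k (u + v * I)‖ ≤ q ^ k * ‖g (u + v * I)‖ := by
      filter_upwards [ae_restrict_mem measurableSet_Ioi] with u hu
      exact hfg k _ (by simpa using (mem_Ioi.1 hu).le)
    have hint (k : ℕ) : IntegrableOn (fun u : ℝ => f k (u + v * I)) (Ioi L) :=
      (hv.norm.const_mul (q ^ k)).mono'
        (continuous_horizontal (hf k) v).aestronglyMeasurable (hle k)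
    have hsum : Summable fun k => ∫ u in Ioi L, ‖f k (u + v * I)‖ := by
      refine Summable.of_nonneg_of_le (fun k => integral_nonneg fun _ => norm_nonneg _)
        (fun k => ?_) (hgeom.mul_right (∫ u in Ioi L, ‖g (u + v * I)‖))
      rw [← integral_const_mul]
      exact integral_mono_ae (hint k).norm (hv.norm.const_mul _) (hle k)
    have htsum : ∫ u in Ioi L, F (u + v * I) = ∫ u in Ioi L, ∑' k, f k (u + v * I) :=
      setIntegral_congr_fun measurableSet_Ioi fun u (hu : L < u) =>
        (hF _ (by simpa using hu.le)).tsum_eq.symm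
    rw [htsum]
    exact hasSum_integral_of_summable_integral_norm hint hsum
  refine ((horizontal θ hp).sub (horizontal (-θ) hm)).add (HasSum.mul_left I ?_)
  refine intervalIntegral.hasSum_integral_of_dominated_convergence
    (fun k v => q ^ k * ‖g (L + v * I)‖)
    (fun k => (continuous_vertical (hf k) L).aestronglyMeasurable)
    (fun k => ae_of_all _ fun v _ => hfg k _ (by simp))
    (ae_of_all _ fun v _ => hgeom.mul_right _) ?_ (ae_of_all _ fun v _ => hF _ (by simp))
  simp_rw [tsum_mul_right]
  exact ((continuous_vertical hg L).norm.const_mul _).intervalIntegrable _ _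

lemma hasDerivAt_hankelKernel (a : ℝ) (w : ℂ) :
    HasDerivAt (hankelKernel a) (hankelKernel (a + 1) w + a * hankelKernel a w) w := by
  have h := ((hasDerivAt_exp w).add ((hasDerivAt_id w).const_mul (a : ℂ))).cexp
  convert! h using 1
  simp only [hankelKernel, Pi.add_apply, id]
  rw [show exp w + ((a + 1 : ℝ) : ℂ) * w = (exp w + a * w) + w by push_cast; ring, exp_add _ w]
  ring

lemma hankelIntegral_hankelKernel_add_one {θ : ℝ} (hc : Real.cos θ < 0) (a L : ℝ) :
    hankelIntegral θ L (hankelKernel (a + 1)) = -a * hankelIntegral θ L (hankelKernel a) := by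
  have horizontal (v : ℝ) (hv : Real.cos v < 0) :
      (∫ u in Ioi L, hankelKernel (a + 1) (u + v * I))
        + a * (∫ u in Ioi L, hankelKernel a (u + v * I)) = - hankelKernel a (L + v * I) := by
    rw [← integral_const_mul, ← integral_add (integrableOn_hankelKernel hv _ L)
      ((integrableOn_hankelKernel hv _ L).const_mul _), ← zero_sub]
    refine integral_Ioi_of_hasDerivAt_of_tendsto
      (f := fun u : ℝ => hankelKernel a (u + v * I))
      (continuous_horizontal (continuous_hankelKernel a) v).continuousWithinAt (fun u _ => ?_)
      ((integrableOn_hankelKernel hv _ L).add ((integrableOn_hankelKernel hv _ L).const_mul _))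
      (tendsto_hankelKernel_atTop hv a)
    have h1 : HasDerivAt (fun u : ℝ => (u : ℂ) + v * I) 1 u :=
      (hasDerivAt_id u).ofReal_comp.add_const _
    exact ((hasDerivAt_hankelKernel a (u + v * I)).comp u h1).congr_deriv (mul_one _)
  have vertical : I * (∫ v in (-θ)..θ, hankelKernel (a + 1) (L + v * I))
      + a * (I * ∫ v in (-θ)..θ, hankelKernel a (L + v * I))
      = hankelKernel a (L + θ * I) - hankelKernel a (L + (-θ : ℝ) * I) := by
    have hi (b : ℝ) : IntervalIntegrable (fun v : ℝ => hankelKernel b (L + v * I)) volume (-θ) θ :=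
      (continuous_vertical (continuous_hankelKernel b) L).intervalIntegrable _ _
    rw [mul_left_comm, ← mul_add, ← intervalIntegral.integral_const_mul,
      ← intervalIntegral.integral_add (hi _) ((hi _).const_mul _),
      ← intervalIntegral.integral_const_mul]
    refine intervalIntegral.integral_eq_sub_of_hasDerivAt
      (f := fun v : ℝ => hankelKernel a (L + v * I)) (fun v _ => ?_)
      (((hi _).add ((hi _).const_mul _)).const_mul _)
    have h1 : HasDerivAt (fun v : ℝ => (L : ℂ) + v * I) I v := by
      simpa using ((hasDerivAt_id v).ofReal_comp.mul_const I).const_add (L : ℂ)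
    exact ((hasDerivAt_hankelKernel a (L + v * I)).comp v h1).congr_deriv (mul_comm _ _)
  have hp := horizontal θ hc
  have hm := horizontal (-θ) (by simpa using hc)
  unfold hankelIntegral
  linear_combination hp - hm + vertical

lemma integral_hankelKernel_horizontal_eq {a c v₀ v₁ : ℝ} (ha : 0 < a) (hc : 0 < c)
    (hle : v₀ ≤ v₁) (hcos : ∀ v ∈ Icc v₀ v₁, Real.cos v ≤ -c) :
    ∫ u : ℝ, hankelKernel a (u + v₀ * I) = ∫ u : ℝ, hankelKernel a (u + v₁ * I) := by
  have hi {v : ℝ} (hv : v ∈ Icc v₀ v₁) : Integrable (fun u : ℝ => hankelKernel a (u + v * I)) :=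
    integrable_hankelKernel (by linarith [hcos v hv]) ha
  have lim {v : ℝ} (hv : v ∈ Icc v₀ v₁) :
      Tendsto (fun T : ℝ => ∫ u in (-T)..T, hankelKernel a (u + v * I)) atTop
        (𝓝 (∫ u : ℝ, hankelKernel a (u + v * I))) :=
    intervalIntegral_tendsto_integral (hi hv) tendsto_neg_atTop_atBot tendsto_id
  have bound (u v : ℝ) (hv : v ∈ Icc v₀ v₁) :
      ‖hankelKernel a (u + v * I)‖ ≤ Real.exp (a * u - c * Real.exp u) := by
    rw [norm_hankelKernel]
    gcongr
    nlinarith [hcos v hv, Real.exp_pos u]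
  have right : Tendsto (fun T : ℝ => ∫ v in v₀..v₁, hankelKernel a (T + v * I)) atTop (𝓝 0) :=
    tendsto_vertical_integral_zero hle (tendsto_exp_mul_sub_mul_exp_atTop hc a)
      (Eventually.of_forall fun T v hv => bound T v hv)
  have left : Tendsto (fun T : ℝ => ∫ v in v₀..v₁, hankelKernel a (T + v * I)) atBot (𝓝 0) := by
    have hB : Tendsto (fun u : ℝ => Real.exp (a * u)) atBot (𝓝 0) :=
      Real.tendsto_exp_atBot.comp (tendsto_id.const_mul_atBot ha)
    refine tendsto_vertical_integral_zero hle hB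
      (Eventually.of_forall fun T v hv => (bound T v hv).trans ?_)
    gcongr
    linarith [mul_pos hc (Real.exp_pos T)]
  have h := (((lim (left_mem_Icc.2 hle)).sub (lim (right_mem_Icc.2 hle))).add
    (right.const_mul I)).sub ((left.comp tendsto_neg_atTop_atBot).const_mul I)
  have h0 := tendsto_nhds_unique h ((tendsto_const_nhds (x := (0 : ℂ))).congr fun T =>
    (integral_rectangle_eq_zero hle
      (fun w _ => (differentiable_hankelKernel a).differentiableAt) (-T) T).symm)
  simpa [sub_eq_zero] using h0

lemma integral_exp_mul_sub_exp {a : ℝ} (ha : 0 < a) :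
    ∫ u : ℝ, Real.exp (a * u - Real.exp u) = Real.Gamma a := by
  rw [Real.Gamma_eq_integral ha]
  have h := integral_image_eq_integral_abs_deriv_smul MeasurableSet.univ
    (fun x _ => (Real.hasDerivAt_exp x).hasDerivWithinAt) Real.exp_injective.injOn
    (fun x : ℝ => Real.exp (-x) * x ^ (a - 1))
  rw [image_univ, Real.range_exp, setIntegral_univ] at h
  rw [h]
  refine integral_congr_ae (ae_of_all _ fun u => ?_)
  simp only [abs_of_pos (Real.exp_pos u), smul_eq_mul]
  rw [← Real.exp_mul, ← Real.exp_add, ← Real.exp_add]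
  ring_nf

lemma integral_hankelKernel_of_exp_mul_I {a v : ℝ} (ha : 0 < a) (hv : exp (v * I) = -1) :
    ∫ u : ℝ, hankelKernel a (u + v * I) = Real.Gamma a * exp (a * v * I) := by
  rw [← integral_exp_mul_sub_exp ha, ← integral_complex_ofReal, ← integral_mul_const]
  refine integral_congr_ae (ae_of_all _ fun u => ?_)
  simp only [hankelKernel]
  rw [exp_add (u : ℂ), hv]
  push_cast
  rw [← exp_add]
  ring_nf

/-- Hankel's formula for the reciprocal Gamma function. -/
lemma hankelIntegral_hankelKernel_of_pos {θ a : ℝ} (hθ : 0 ≤ θ) (hθπ : θ ≤ Real.pi)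
    (hc : Real.cos θ < 0) (ha : 0 < a) (L : ℝ) :
    hankelIntegral θ L (hankelKernel a) = 2 * Real.pi * I * (Real.Gamma (1 - a))⁻¹ := by
  have hB : Tendsto (fun u : ℝ => Real.exp (1 + a * u)) atBot (𝓝 0) :=
    Real.tendsto_exp_atBot.comp
      (tendsto_atBot_add_const_left _ _ (tendsto_id.const_mul_atBot ha))
  rw [hankelIntegral_eq_integral hθ
    (fun w _ => (differentiable_hankelKernel a).differentiableAt) (integrable_hankelKernel hc ha)
    (integrable_hankelKernel (by simpa using hc) ha) hB
    ((eventually_le_atBot 0).mono fun u hu v _ => norm_hankelKernel_le_of_nonpos hu),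
    integral_hankelKernel_horizontal_eq ha (neg_pos.2 hc) hθπ,
    ← integral_hankelKernel_horizontal_eq ha (neg_pos.2 hc) (neg_le_neg hθπ),
    integral_hankelKernel_of_exp_mul_I ha exp_pi_mul_I,
    integral_hankelKernel_of_exp_mul_I ha (by
      rw [ofReal_neg, neg_mul, exp_neg, exp_pi_mul_I]; norm_num)]
  · have hrefl := Real.Gamma_mul_Gamma_one_sub a
    have hsin : exp (a * Real.pi * I) - exp (a * (-Real.pi : ℝ) * I)
        = 2 * I * (Real.sin (Real.pi * a) : ℝ) := by
      push_cast
      rw [show (a * Real.pi * I : ℂ) = (Real.pi * a : ℂ) * I by ring,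
        show (a * -Real.pi * I : ℂ) = -(Real.pi * a : ℂ) * I by ring, Complex.sin]
      linear_combination (exp ((Real.pi * a : ℂ) * I) - exp (-(Real.pi * a : ℂ) * I)) * I_sq
    rw [← mul_sub, hsin]
    have hΓ : Real.Gamma a * Real.sin (Real.pi * a) = Real.pi * (Real.Gamma (1 - a))⁻¹ := by
      have hΓa := (Real.Gamma_pos_of_pos ha).ne'
      by_cases hs : Real.sin (Real.pi * a) = 0
      · rw [hs, div_zero] at hrefl
        have : Real.Gamma (1 - a) = 0 := (mul_eq_zero.1 hrefl).resolve_left hΓa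
        simp [hs, this]
      · have h1 : Real.Gamma (1 - a) ≠ 0 := by
          intro h0
          rw [h0, mul_zero] at hrefl
          exact div_ne_zero Real.pi_ne_zero hs hrefl.symm
        rw [eq_div_iff hs] at hrefl
        rw [eq_mul_inv_iff_mul_eq₀ h1]
        linarith
    have hΓ' := congrArg (fun x : ℝ => (x : ℂ)) hΓ
    push_cast at hΓ' ⊢
    linear_combination 2 * I * hΓ'
  · intro v hv
    rw [neg_neg, ← Real.cos_neg v]
    exact Real.cos_le_cos_of_nonneg_of_le_pi hθ (by linarith [hv.1]) (by linarith [hv.2])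
  · intro v hv
    rw [neg_neg]
    exact Real.cos_le_cos_of_nonneg_of_le_pi hθ hv.2 hv.1

lemma continuousWithinAt_hankelIntegral_hankelKernel {θ : ℝ} (hc : Real.cos θ < 0) (L : ℝ) :
    ContinuousWithinAt (fun a => hankelIntegral θ L (hankelKernel a)) (Ioi 0) 0 := by
  have horizontal (v : ℝ) (hv : Real.cos v < 0) :
      ContinuousWithinAt (fun a => ∫ u in Ioi L, hankelKernel a (u + v * I)) (Ioi 0) 0 := by
    refine continuousWithinAt_of_dominated
      (F := fun (a u : ℝ) => hankelKernel a (u + v * I))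
      (bound := fun u : ℝ => ‖hankelKernel 0 (u + v * I)‖ + ‖hankelKernel 1 (u + v * I)‖)
      (Eventually.of_forall fun a =>
        (continuous_horizontal (continuous_hankelKernel a) v).aestronglyMeasurable)
      ?_ ((integrableOn_hankelKernel hv 0 L).norm.add (integrableOn_hankelKernel hv 1 L).norm)
      (ae_of_all _ fun u => Continuous.continuousWithinAt (by unfold hankelKernel; fun_prop))
    filter_upwards [Ioc_mem_nhdsGT one_pos] with a ha
    refine ae_of_all _ fun u => ?_
    simp only [norm_hankelKernel]
    rcases le_total u 0 with hu | hu
    · refine le_add_of_le_of_nonneg (Real.exp_le_exp.2 ?_) (Real.exp_nonneg _)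
      nlinarith [ha.1]
    · refine le_add_of_nonneg_of_le (Real.exp_nonneg _) (Real.exp_le_exp.2 ?_)
      nlinarith [ha.2]
  have vertical : Continuous fun a : ℝ => ∫ v in (-θ)..θ, hankelKernel a (L + v * I) :=
    intervalIntegral.continuous_parametric_intervalIntegral_of_continuous'
      (by unfold hankelKernel; fun_prop) _ _
  exact ((horizontal θ hc).sub (horizontal (-θ) (by simpa using hc))).add
    (vertical.continuousWithinAt.const_mul I)

theorem hankelIntegral_hankelKernel {θ : ℝ} (hθ : 0 ≤ θ) (hθπ : θ ≤ Real.pi)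
    (hc : Real.cos θ < 0) (a L : ℝ) :
    hankelIntegral θ L (hankelKernel a) = 2 * Real.pi * I * (Real.Gamma (1 - a))⁻¹ := by
  have nonneg : ∀ a : ℝ, 0 ≤ a →
      hankelIntegral θ L (hankelKernel a) = 2 * Real.pi * I * (Real.Gamma (1 - a))⁻¹ := by
    intro a ha
    rcases ha.eq_or_lt with rfl | ha
    · have hcont : ContinuousAt (fun a : ℝ => (2 * Real.pi * I * (Real.Gamma (1 - a))⁻¹ : ℂ)) 0 := by
        have hG : ContinuousAt Real.Gamma (1 - 0) :=
          (Real.differentiableAt_Gamma fun m => by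
            have : (0 : ℝ) ≤ m := m.cast_nonneg
            linarith).continuousAt
        have hG' : ContinuousAt (fun a : ℝ => Real.Gamma (1 - a)) 0 :=
          ContinuousAt.comp (f := fun a : ℝ => 1 - a) hG (by fun_prop)
        exact continuousAt_const.mul
          (continuous_ofReal.continuousAt.comp (hG'.inv₀ (by simp)))
      refine tendsto_nhds_unique
        ((continuousWithinAt_hankelIntegral_hankelKernel hc L).tendsto.congr' ?_)
        (hcont.tendsto.mono_left nhdsWithin_le_nhds)
      filter_upwards [self_mem_nhdsWithin] with a ha
      exact hankelIntegral_hankelKernel_of_pos hθ hθπ hc ha L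
    · exact hankelIntegral_hankelKernel_of_pos hθ hθπ hc ha L
  have step : ∀ (n : ℕ) (a : ℝ), -n ≤ a →
      hankelIntegral θ L (hankelKernel a) = 2 * Real.pi * I * (Real.Gamma (1 - a))⁻¹ := by
    intro n
    induction n with
    | zero => simpa using nonneg
    | succ n ih =>
      intro a ha
      rcases le_or_gt 0 a with h0 | h0
      · exact nonneg a h0
      · push_cast at ha
        have h1 := ih (a + 1) (by linarith)
        rw [hankelIntegral_hankelKernel_add_one hc, show 1 - (a + 1) = -a by ring] at h1
        rw [show 1 - a = -a + 1 by ring, Real.Gamma_add_one (by linarith), mul_inv, ofReal_mul]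
        have ha0 : (a : ℂ) ≠ 0 := ofReal_ne_zero.2 h0.ne
        rw [mul_left_comm, ← h1, ofReal_inv, ofReal_neg]
        field_simp
  obtain ⟨n, hn⟩ := exists_nat_ge (-a)
  exact step n a (by linarith)

lemma mul_sin_le_norm_add_exp {z φ : ℝ} (w : ℂ) (hz : 0 ≤ z) (hφ : φ ≤ Real.pi)
    (hw : |w.im| ≤ φ) : z * Real.sin φ ≤ ‖exp w + z‖ := by
  have hcos : Real.cos φ ≤ Real.cos w.im := by
    rw [← Real.cos_abs w.im]
    exact Real.cos_le_cos_of_nonneg_of_le_pi (abs_nonneg _) hφ hw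
  refine abs_le_of_sq_le_sq' ?_ (norm_nonneg _) |>.2
  rw [← normSq_eq_norm_sq, normSq_apply]
  simp only [add_re, add_im, ofReal_re, ofReal_im, exp_re, exp_im]
  have h1 := mul_le_mul_of_nonneg_left hcos (mul_nonneg hz (Real.exp_nonneg w.re))
  calc (z * Real.sin φ) ^ 2
      ≤ (z * Real.sin φ) ^ 2 + (Real.exp w.re + z * Real.cos φ) ^ 2 :=
        le_add_of_nonneg_right (sq_nonneg _)
    _ = z ^ 2 + Real.exp w.re ^ 2 + 2 * (z * Real.exp w.re * Real.cos φ) := by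
        linear_combination z ^ 2 * Real.sin_sq_add_cos_sq φ
    _ ≤ z ^ 2 + Real.exp w.re ^ 2 + 2 * (z * Real.exp w.re * Real.cos w.im) := by gcongr
    _ = _ := by linear_combination -Real.exp w.re ^ 2 * Real.sin_sq_add_cos_sq w.im

/-- The integrand representing `E_{α,β}(-z)` along a Hankel contour. -/
noncomputable def mittagLefflerKernel (α β z : ℝ) (w : ℂ) : ℂ :=
  hankelKernel (1 - β + α) w / (exp (α * w) + z)

lemma hankelKernel_add (a b : ℝ) (w : ℂ) :
    hankelKernel (a + b) w = hankelKernel a w * exp (b * w) := by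
  rw [hankelKernel, hankelKernel, ← exp_add]
  push_cast
  ring_nf

section

variable {α β θ z : ℝ}

lemma mul_sin_le_norm_exp_mul_add (hα : 0 < α) (hαθ : α * θ ≤ Real.pi) (hz : 0 ≤ z) {w : ℂ}
    (hw : w.im ∈ Icc (-θ) θ) : z * Real.sin (α * θ) ≤ ‖exp (α * w) + z‖ := by
  refine mul_sin_le_norm_add_exp _ hz hαθ ?_
  rw [im_ofReal_mul, abs_mul, abs_of_pos hα]
  exact mul_le_mul_of_nonneg_left (abs_le.2 hw) hα.le

lemma exp_mul_add_ne_zero (hα : 0 < α) (hθ : 0 < θ) (hαθ : α * θ < Real.pi) (hz : 0 < z) {w : ℂ}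
    (hw : w.im ∈ Icc (-θ) θ) : exp (α * w) + z ≠ 0 := by
  rw [← norm_pos_iff]
  exact (mul_pos hz (Real.sin_pos_of_pos_of_lt_pi (mul_pos hα hθ) hαθ)).trans_le
    (mul_sin_le_norm_exp_mul_add hα hαθ.le hz.le hw)

lemma norm_div_exp_mul_add_le (hα : 0 < α) (hθ : 0 < θ) (hαθ : α * θ < Real.pi) (hz : 0 < z)
    {w : ℂ} (hw : w.im ∈ Icc (-θ) θ) (x : ℂ) :
    ‖x / (exp (α * w) + z)‖ ≤ (z * Real.sin (α * θ))⁻¹ * ‖x‖ := by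
  rw [norm_div, div_eq_inv_mul]
  gcongr
  · exact mul_pos hz (Real.sin_pos_of_pos_of_lt_pi (mul_pos hα hθ) hαθ)
  · exact mul_sin_le_norm_exp_mul_add hα hαθ.le hz.le hw

lemma differentiableAt_mittagLefflerKernel (hα : 0 < α) (hθ : 0 < θ) (hαθ : α * θ < Real.pi)
    (hz : 0 < z) {w : ℂ} (hw : w.im ∈ Icc (-θ) θ) :
    DifferentiableAt ℂ (mittagLefflerKernel α β z) w :=
  (differentiable_hankelKernel _).differentiableAt.div (by fun_prop)
    (exp_mul_add_ne_zero hα hθ hαθ hz hw)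

lemma integrable_hankelKernel_div {a v : ℝ} (hα : 0 < α) (hθ : 0 < θ) (hαθ : α * θ < Real.pi)
    (hz : 0 < z) (ha : 0 < a) (hc : Real.cos v < 0) (hv : v ∈ Icc (-θ) θ) :
    Integrable (fun u : ℝ => hankelKernel a (u + v * I) / (exp (α * (u + v * I)) + z)) := by
  refine ((integrable_hankelKernel hc ha).norm.const_mul _).mono'
    (Continuous.aestronglyMeasurable ?_)
    (ae_of_all _ fun u => norm_div_exp_mul_add_le hα hθ hαθ hz (by simpa using hv) _)
  exact (continuous_horizontal (continuous_hankelKernel a) v).div (by fun_prop)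
    fun u => exp_mul_add_ne_zero hα hθ hαθ hz (by simpa using hv)

lemma hankelIntegral_mittagLefflerKernel (hα : 0 < α) (hβ : β < 1 + α) (hθ : 0 < θ)
    (hc : Real.cos θ < 0) (hαθ : α * θ < Real.pi) (hz : 0 < z) (L : ℝ) :
    hankelIntegral θ L (mittagLefflerKernel α β z)
      = (∫ u : ℝ, mittagLefflerKernel α β z (u + θ * I))
        - ∫ u : ℝ, mittagLefflerKernel α β z (u + (-θ : ℝ) * I) := by
  have ha : 0 < 1 - β + α := by linarith
  have hB : Tendsto (fun u : ℝ => (z * Real.sin (α * θ))⁻¹ * Real.exp (1 + (1 - β + α) * u)) atBot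
      (𝓝 ((z * Real.sin (α * θ))⁻¹ * 0)) :=
    (Real.tendsto_exp_atBot.comp
      (tendsto_atBot_add_const_left _ _ (tendsto_id.const_mul_atBot ha))).const_mul _
  rw [mul_zero] at hB
  refine hankelIntegral_eq_integral hθ.le
    (fun w hw => differentiableAt_mittagLefflerKernel hα hθ hαθ hz hw)
    (integrable_hankelKernel_div hα hθ hαθ hz ha hc ⟨by linarith, le_rfl⟩)
    (integrable_hankelKernel_div hα hθ hαθ hz ha (by simpa using hc) ⟨le_rfl, by linarith⟩) hB
    ((eventually_le_atBot 0).mono fun u hu v hv => ?_) L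
  refine (norm_div_exp_mul_add_le hα hθ hαθ hz (by simpa using hv) _).trans ?_
  have := Real.sin_pos_of_pos_of_lt_pi (mul_pos hα hθ) hαθ
  gcongr
  exact norm_hankelKernel_le_of_nonpos hu

lemma neg_pow_mul_hankelKernel (k : ℕ) (w : ℂ) :
    (-z : ℂ) ^ k * hankelKernel (1 - (k * α + β)) w
      = hankelKernel (1 - β) w * (-(z * exp (-(α * w)))) ^ k := by
  rw [show 1 - (k * α + β) = 1 - β + (-(k * α)) by ring, hankelKernel_add, neg_mul_eq_neg_mul (z : ℂ),
    mul_pow, ← exp_nat_mul]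
  push_cast
  ring_nf

lemma hasSum_mittagLefflerKernel {w : ℂ} (hw : ‖z * exp (-(α * w))‖ < 1) :
    HasSum (fun k : ℕ => (-z : ℂ) ^ k * hankelKernel (1 - (k * α + β)) w)
      (mittagLefflerKernel α β z w) := by
  have h := (hasSum_geometric_of_norm_lt_one (ξ := -(z * exp (-(α * w))))
    (by rwa [norm_neg])).mul_left (hankelKernel (1 - β) w)
  simp_rw [neg_pow_mul_hankelKernel]
  have hF : mittagLefflerKernel α β z w
      = hankelKernel (1 - β) w * (1 - -(z * exp (-(α * w))))⁻¹ := by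
    rw [mittagLefflerKernel, hankelKernel_add, exp_neg, sub_neg_eq_add]
    have h0 := exp_ne_zero (α * w)
    rw [show 1 + z * (exp (α * w))⁻¹ = (exp (α * w) + z) * (exp (α * w))⁻¹ by field_simp,
      mul_inv, inv_inv, div_eq_mul_inv, mul_assoc, mul_comm (exp _)]
  rwa [hF]

/-- The contour integral representation of the Mittag-Leffler function. -/
lemma two_pi_I_mul_mittagLefflerReal (hα : 0 < α) (hβ : β < 1 + α) (hθ : 0 < θ)
    (hθπ : θ ≤ Real.pi) (hc : Real.cos θ < 0) (hαθ : α * θ < Real.pi) (hz : 0 < z) :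
    2 * Real.pi * I * mittagLefflerReal α β (-z)
      = (∫ u : ℝ, mittagLefflerKernel α β z (u + θ * I))
        - ∫ u : ℝ, mittagLefflerKernel α β z (u + (-θ : ℝ) * I) := by
  obtain ⟨L, hL⟩ : ∃ L : ℝ, z * Real.exp (-(α * L)) < 1 := by
    refine ⟨(Real.log z + 1) / α, ?_⟩
    rw [mul_div_cancel₀ _ hα.ne', neg_add, Real.exp_add, Real.exp_neg, Real.exp_log hz,
      ← mul_assoc, mul_inv_cancel₀ hz.ne', one_mul, Real.exp_lt_one_iff]
    norm_num
  have hnorm (w : ℂ) : ‖(z : ℂ) * exp (-(α * w))‖ = z * Real.exp (-(α * w.re)) := by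
    simp [norm_exp, abs_of_pos hz]
  have hnorm_le (w : ℂ) (hw : L ≤ w.re) :
      ‖(z : ℂ) * exp (-(α * w))‖ ≤ z * Real.exp (-(α * L)) := by
    rw [hnorm]
    gcongr
  have hsum := hankelIntegral_hasSum (θ := θ) (L := L) (by positivity) hL
    (f := fun k w => (-z : ℂ) ^ k * hankelKernel (1 - (k * α + β)) w)
    (fun k => (continuous_hankelKernel _).const_mul _) (continuous_hankelKernel (1 - β))
    (integrableOn_hankelKernel hc _ L) (integrableOn_hankelKernel (by simpa using hc) _ L)
    (fun k w hw => ?_)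
    (fun w hw => hasSum_mittagLefflerKernel ((hnorm_le w hw).trans_lt hL))
  · rw [hankelIntegral_mittagLefflerKernel hα hβ hθ hc hαθ hz] at hsum
    rw [← hsum.tsum_eq, mittagLefflerReal, ofReal_tsum, ← tsum_mul_left]
    refine tsum_congr fun k => ?_
    have hk : hankelIntegral θ L (fun w => (-z : ℂ) ^ k * hankelKernel (1 - (k * α + β)) w)
        = (-z : ℂ) ^ k * hankelIntegral θ L (hankelKernel (1 - (k * α + β))) := by
      simp only [hankelIntegral, integral_const_mul, intervalIntegral.integral_const_mul]
      ring
    rw [hk, hankelIntegral_hankelKernel hθ.le hθπ hc, sub_sub_cancel]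
    push_cast
    ring
  · rw [neg_pow_mul_hankelKernel, norm_mul, norm_pow, norm_neg, mul_comm]
    gcongr
    exact hnorm_le w hw

end

/-- The leading-order expansion of `E_{α,β}(-z)` as `z → ∞`. -/
theorem mittagLefflerReal_sub_isBigO {α β : ℝ} (hα : 0 < α) (hα2 : α < 2) (hβ : β < 1 + α) :
    (fun z : ℝ => mittagLefflerReal α β (-z) - 1 / (Real.Gamma (β - α) * z))
      =O[atTop] fun z : ℝ => 1 / z ^ 2 := by
  obtain ⟨θ, hθ1, hθ2⟩ : ∃ θ, Real.pi / 2 < θ ∧ θ < min Real.pi (Real.pi / α) := by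
    refine exists_between (lt_min (by linarith [Real.pi_pos]) ?_)
    gcongr
  have hθ0 : 0 < θ := by linarith [Real.pi_pos]
  have hθπ : θ ≤ Real.pi := (hθ2.trans_le (min_le_left _ _)).le
  have hαθ : α * θ < Real.pi := by
    rw [mul_comm]
    exact (lt_div_iff₀ hα).1 (hθ2.trans_le (min_le_right _ _))
  have hc : Real.cos θ < 0 := Real.cos_neg_of_pi_div_two_lt_of_lt hθ1 (by linarith)
  have ha : 0 < 1 - β + α := by linarith
  have ha' : 0 < 1 - β + α + α := by linarith
  let N (v : ℝ) : ℝ := ∫ u : ℝ, ‖hankelKernel (1 - β + α + α) (u + v * I)‖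
  have line (z v : ℝ) (hz : 0 < z) (hcv : Real.cos v < 0) (hv : v ∈ Icc (-θ) θ) :
      ‖z * (∫ u : ℝ, mittagLefflerKernel α β z (u + v * I))
        - ∫ u : ℝ, hankelKernel (1 - β + α) (u + v * I)‖ ≤ (z * Real.sin (α * θ))⁻¹ * N v := by
    have hint : Integrable (fun u : ℝ => mittagLefflerKernel α β z (u + v * I)) :=
      integrable_hankelKernel_div hα hθ0 hαθ hz ha hcv hv
    rw [← integral_const_mul, ← integral_sub (hint.const_mul _)
      (integrable_hankelKernel hcv ha), ← integral_const_mul]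
    refine norm_integral_le_of_norm_le ((integrable_hankelKernel hcv ha').norm.const_mul _)
      (ae_of_all _ fun u => ?_)
    have hw : ((u : ℂ) + v * I).im ∈ Icc (-θ) θ := by simpa using hv
    have hne := exp_mul_add_ne_zero hα hθ0 hαθ hz hw
    have hid : z * mittagLefflerKernel α β z (u + v * I) - hankelKernel (1 - β + α) (u + v * I)
        = -(hankelKernel (1 - β + α + α) (u + v * I) / (exp (α * (u + v * I)) + z)) := by
      rw [mittagLefflerKernel, hankelKernel_add (1 - β + α) α]
      generalize exp (α * (u + v * I)) = e at hne ⊢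
      field_simp
      ring
    rw [hid, norm_neg]
    exact norm_div_exp_mul_add_le hα hθ0 hαθ hz hw _
  have hGamma : 2 * Real.pi * I * (Real.Gamma (β - α))⁻¹
      = (∫ u : ℝ, hankelKernel (1 - β + α) (u + θ * I))
        - ∫ u : ℝ, hankelKernel (1 - β + α) (u + (-θ : ℝ) * I) := by
    have hB : Tendsto (fun u : ℝ => Real.exp (1 + (1 - β + α) * u)) atBot (𝓝 0) :=
      Real.tendsto_exp_atBot.comp
        (tendsto_atBot_add_const_left _ _ (tendsto_id.const_mul_atBot ha))
    rw [← hankelIntegral_eq_integral hθ0.le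
      (fun w _ => (differentiable_hankelKernel _).differentiableAt)
      (integrable_hankelKernel hc ha) (integrable_hankelKernel (by simpa using hc) ha) hB
      ((eventually_le_atBot 0).mono fun u hu v _ => norm_hankelKernel_le_of_nonpos hu) 0,
      hankelIntegral_hankelKernel hθ0.le hθπ hc]
    ring_nf
  refine Asymptotics.IsBigO.of_bound
    ((Real.sin (α * θ))⁻¹ * (N θ + N (-θ)) / (2 * Real.pi)) ?_
  filter_upwards [eventually_gt_atTop 0] with z hz
  have hp := line z θ hz hc ⟨by linarith, le_rfl⟩
  have hm := line z (-θ) hz (by simpa using hc) ⟨le_rfl, by linarith⟩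
  have hE := two_pi_I_mul_mittagLefflerReal hα hβ hθ0 hθπ hc hαθ hz
  have hdiff : 2 * Real.pi * I * (z * (mittagLefflerReal α β (-z)
        - 1 / (Real.Gamma (β - α) * z) : ℝ))
      = (z * (∫ u : ℝ, mittagLefflerKernel α β z (u + θ * I))
          - ∫ u : ℝ, hankelKernel (1 - β + α) (u + θ * I))
        - (z * (∫ u : ℝ, mittagLefflerKernel α β z (u + (-θ : ℝ) * I))
          - ∫ u : ℝ, hankelKernel (1 - β + α) (u + (-θ : ℝ) * I)) := by
    have hz' : (z : ℂ) ≠ 0 := ofReal_ne_zero.2 hz.ne'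
    have hcancel : (z : ℂ) * (1 / (Real.Gamma (β - α) * z)) = (Real.Gamma (β - α) : ℂ)⁻¹ := by
      rw [one_div, mul_inv, mul_left_comm, mul_inv_cancel₀ hz', mul_one]
    push_cast at hGamma ⊢
    push_cast at hE
    linear_combination z * hE - hGamma - 2 * Real.pi * I * hcancel
  have hle := (norm_sub_le _ _).trans (add_le_add hp hm)
  rw [← hdiff, norm_mul, norm_mul, norm_mul, norm_mul, norm_I, norm_real, norm_real, norm_real,
    Real.norm_of_nonneg hz.le, Real.norm_of_nonneg Real.pi_pos.le, mul_one, RCLike.norm_ofNat] at hle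
  rw [Real.norm_of_nonneg (by positivity : 0 ≤ 1 / z ^ 2)]
  have hpos : 0 < 2 * Real.pi * z := by positivity
  rw [← mul_le_mul_iff_right₀ hpos, mul_assoc]
  refine hle.trans (le_of_eq ?_)
  have := Real.pi_ne_zero
  field_simp

end HankelContour

/-- For `1 < α < 2`: `E_{α,1}(-z) = 1/(Γ(1-α) z) + O(1/z²)` and
`E_{α,2}(-z) = 1/(Γ(2-α) z) + O(1/z²)` as `z → ∞`; in particular there is `z₀ > 0` such that
for all `z ≥ z₀`, `E_{α,1}(-z) ≤ 1/(2Γ(1-α) z) < 0` and `E_{α,2}(-z) ≥ 1/(2Γ(2-α) z) > 0`. -/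
theorem mittagLeffler_asymptotics (α : ℝ) (hα1 : 1 < α) (hα2 : α < 2) :
    ((fun z : ℝ => mittagLefflerReal α 1 (-z) - 1 / (Real.Gamma (1 - α) * z))
        =O[atTop] fun z : ℝ => 1 / z ^ 2) ∧
    ((fun z : ℝ => mittagLefflerReal α 2 (-z) - 1 / (Real.Gamma (2 - α) * z))
        =O[atTop] fun z : ℝ => 1 / z ^ 2) ∧
    ∃ z₀ : ℝ, 0 < z₀ ∧ ∀ z : ℝ, z₀ ≤ z →
      (mittagLefflerReal α 1 (-z) ≤ 1 / (2 * Real.Gamma (1 - α) * z) ∧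
        1 / (2 * Real.Gamma (1 - α) * z) < 0) ∧
      (mittagLefflerReal α 2 (-z) ≥ 1 / (2 * Real.Gamma (2 - α) * z) ∧
        0 < 1 / (2 * Real.Gamma (2 - α) * z)) := by
  have h1 := mittagLefflerReal_sub_isBigO (β := 1) (by linarith) hα2 (by linarith)
  have h2 := mittagLefflerReal_sub_isBigO (β := 2) (by linarith) hα2 (by linarith)
  have hΓ2 : 0 < Real.Gamma (2 - α) := Real.Gamma_pos_of_pos (by linarith)
  have hΓ1 : Real.Gamma (1 - α) < 0 := by
    have h := Real.Gamma_add_one (s := 1 - α) (by linarith)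
    rw [show 1 - α + 1 = 2 - α by ring] at h
    nlinarith
  have close {f : ℝ → ℝ} (h : f =O[atTop] fun z : ℝ => 1 / z ^ 2) {ε : ℝ} (hε : 0 < ε) :
      ∀ᶠ z in atTop, |f z| ≤ ε / z := by
    obtain ⟨C, hC⟩ := h.bound
    filter_upwards [hC, eventually_ge_atTop (C / ε), eventually_gt_atTop 0] with z hz hzC hz0
    rw [Real.norm_eq_abs, Real.norm_of_nonneg (by positivity)] at hz
    refine hz.trans ?_
    rw [div_le_iff₀ hε] at hzC
    rw [mul_one_div, div_le_div_iff₀ (by positivity) hz0]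
    nlinarith
  refine ⟨h1, h2, ?_⟩
  obtain ⟨z₀, hz₀⟩ := eventually_atTop.1 (((close h1
    (ε := -(1 / (2 * Real.Gamma (1 - α)))) (by
      rw [neg_pos, one_div_neg]; linarith)).and
    (close h2 (ε := 1 / (2 * Real.Gamma (2 - α))) (by positivity))).and (eventually_gt_atTop 0))
  refine ⟨z₀, (hz₀ z₀ le_rfl).2, fun z hz => ?_⟩
  obtain ⟨⟨hz1, hz2⟩, hz0⟩ := hz₀ z hz
  have half (g : ℝ) : 1 / (g * z) = 2 * (1 / (2 * g * z)) := by
    rw [mul_assoc 2 g z, one_div, one_div, mul_inv 2, ← mul_assoc, mul_inv_cancel₀ two_ne_zero,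
      one_mul]
  rw [half, neg_div, div_div] at hz1
  rw [half, div_div] at hz2
  refine ⟨⟨by linarith [(abs_le.1 hz1).2], ?_⟩, by linarith [(abs_le.1 hz2).1], by positivity⟩
  rw [one_div_neg]
  nlinarith
end
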